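/- Let 𝒞 be a preadditive category with binary biproducts and let C, b₁, D, b₂, E, F be objects of 𝒞. Let α : C ⟶ b₁, β : C ⟶ D, φ : b₁ ⟶ b₂, δ : D ⟶ b₂, γ : b₁ ⟶ E, ε : D ⟶ E, μ : b₂ ⟶ F, ν : E ⟶ F be morphisms, and consider the cochain complex concentrated in degrees 0,1,2,3 with objects C, b₁ ⊞ D, b₂ ⊞ E, F (zero elsewhere), whose differential C ⟶ b₁ ⊞ D has components α and β, whose differential b₁ ⊞ D ⟶ b₂ ⊞ E is the biproduct matrix with entries φ, δ, γ, ε, and whose differential b₂ ⊞ E ⟶ F has components μ and ν; assume the composite of each pair of consecutive differentials is zero, so this is indeed a complex. If φ is an isomorphism, then this complex is homotopy equivalent to the cochain complex concentrated in degrees 0,1,2,3 with objects C, D, E, F whose differentials are β : C ⟶ D, ε − γ ∘ φ⁻¹ ∘ δ : D ⟶ E, and ν : E ⟶ F. -/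

import Mathlib

open CategoryTheory CategoryTheory.Limits ZeroObject

variable {𝒞 : Type*} [Category 𝒞] [Preadditive 𝒞] [HasZeroObject 𝒞] [HasBinaryBiproducts 𝒞]

/-- The sequence of objects of a cochain complex concentrated in degrees `0, 1, 2, 3`,
with objects `X0, X1, X2, X3` there and the zero object elsewhere. -/
noncomputable def fourObj (X0 X1 X2 X3 : 𝒞) : ℤ → 𝒞
  | 0 => X0
  | 1 => X1
  | 2 => X2
  | 3 => X3
  | _ => 0

/-- The differentials of a cochain complex concentrated in degrees `0, 1, 2, 3`, given by
`d0 : X0 ⟶ X1`, `d1 : X1 ⟶ X2`, `d2 : X2 ⟶ X3` and zero elsewhere. -/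
noncomputable def fourDiff (X0 X1 X2 X3 : 𝒞) (d0 : X0 ⟶ X1) (d1 : X1 ⟶ X2) (d2 : X2 ⟶ X3) :
    ∀ n : ℤ, fourObj X0 X1 X2 X3 n ⟶ fourObj X0 X1 X2 X3 (n + 1)
  | 0 => d0
  | 1 => d1
  | 2 => d2
  | _ => 0

omit [Preadditive 𝒞] [HasBinaryBiproducts 𝒞] in
/-- A four-term sequence of objects vanishes outside the degrees `0, 1, 2, 3`. -/
theorem isZero_fourObj (X0 X1 X2 X3 : 𝒞) {n : ℤ} (h0 : n ≠ 0) (h1 : n ≠ 1) (h2 : n ≠ 2)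
    (h3 : n ≠ 3) : IsZero (fourObj X0 X1 X2 X3 n) := by
  unfold fourObj
  split
  · exact absurd rfl h0
  · exact absurd rfl h1
  · exact absurd rfl h2
  · exact absurd rfl h3
  · exact isZero_zero 𝒞

/-- The graded morphism between four-term sequences of objects with the given components. -/
noncomputable def fourMap {X0 X1 X2 X3 Y0 Y1 Y2 Y3 : 𝒞} (f0 : X0 ⟶ Y0) (f1 : X1 ⟶ Y1)
    (f2 : X2 ⟶ Y2) (f3 : X3 ⟶ Y3) : ∀ n : ℤ, fourObj X0 X1 X2 X3 n ⟶ fourObj Y0 Y1 Y2 Y3 n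
  | 0 => f0
  | 1 => f1
  | 2 => f2
  | 3 => f3
  | _ => 0

omit [HasBinaryBiproducts 𝒞] in
/-- Componentwise commutation with the differentials of four-term sequences. -/
theorem fourMap_comm {X0 X1 X2 X3 Y0 Y1 Y2 Y3 : 𝒞} {d0 : X0 ⟶ X1} {d1 : X1 ⟶ X2} {d2 : X2 ⟶ X3}
    {e0 : Y0 ⟶ Y1} {e1 : Y1 ⟶ Y2} {e2 : Y2 ⟶ Y3} {f0 : X0 ⟶ Y0} {f1 : X1 ⟶ Y1}
    {f2 : X2 ⟶ Y2} {f3 : X3 ⟶ Y3} (h0 : f0 ≫ e0 = d0 ≫ f1) (h1 : f1 ≫ e1 = d1 ≫ f2)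
    (h2 : f2 ≫ e2 = d2 ≫ f3) (n : ℤ) :
    fourMap f0 f1 f2 f3 n ≫ fourDiff Y0 Y1 Y2 Y3 e0 e1 e2 n =
      fourDiff X0 X1 X2 X3 d0 d1 d2 n ≫ fourMap f0 f1 f2 f3 (n + 1) := by
  by_cases n0 : n = 0
  · subst n0; exact h0
  by_cases n1 : n = 1
  · subst n1; exact h1
  by_cases n2 : n = 2
  · subst n2; exact h2
  by_cases n3 : n = 3
  · subst n3; exact (isZero_zero 𝒞).eq_of_tgt _ _
  · exact (isZero_fourObj _ _ _ _ n0 n1 n2 n3).eq_of_src _ _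

omit [HasZeroObject 𝒞] [HasBinaryBiproducts 𝒞] in
/-- The differential of `CochainComplex.of`, stated for the projection of the complex. -/
theorem cochainComplex_of_d (X : ℤ → 𝒞) (d : ∀ n, X n ⟶ X (n + 1))
    (sq : ∀ n, d n ≫ d (n + 1) = 0) (n : ℤ) : (CochainComplex.of X d sq).d n (n + 1) = d n :=
  CochainComplex.of_d X d n

/-- The chain map between four-term complexes with the given components. -/
noncomputable def fourHom {X0 X1 X2 X3 Y0 Y1 Y2 Y3 : 𝒞} {d0 : X0 ⟶ X1} {d1 : X1 ⟶ X2}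
    {d2 : X2 ⟶ X3} {e0 : Y0 ⟶ Y1} {e1 : Y1 ⟶ Y2} {e2 : Y2 ⟶ Y3}
    (hd : ∀ n, fourDiff X0 X1 X2 X3 d0 d1 d2 n ≫ fourDiff X0 X1 X2 X3 d0 d1 d2 (n + 1) = 0)
    (he : ∀ n, fourDiff Y0 Y1 Y2 Y3 e0 e1 e2 n ≫ fourDiff Y0 Y1 Y2 Y3 e0 e1 e2 (n + 1) = 0)
    (f0 : X0 ⟶ Y0) (f1 : X1 ⟶ Y1) (f2 : X2 ⟶ Y2) (f3 : X3 ⟶ Y3)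
    (h0 : f0 ≫ e0 = d0 ≫ f1) (h1 : f1 ≫ e1 = d1 ≫ f2) (h2 : f2 ≫ e2 = d2 ≫ f3) :
    CochainComplex.of (fourObj X0 X1 X2 X3) (fourDiff X0 X1 X2 X3 d0 d1 d2) hd ⟶
      CochainComplex.of (fourObj Y0 Y1 Y2 Y3) (fourDiff Y0 Y1 Y2 Y3 e0 e1 e2) he :=
  CochainComplex.ofHom (fourMap f0 f1 f2 f3) fun n => by
    rw [cochainComplex_of_d, cochainComplex_of_d]
    exact fourMap_comm h0 h1 h2 n

/-- The family of morphisms of degree `-1` between four-term sequences of objects whose only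
nonzero component goes from degree `2` to degree `1`. -/
noncomputable def fourPrehomotopy {X0 X1 X2 X3 Y0 Y1 Y2 Y3 : 𝒞} (h : X2 ⟶ Y1) (i j : ℤ) :
    fourObj X0 X1 X2 X3 i ⟶ fourObj Y0 Y1 Y2 Y3 j :=
  if hij : i = 2 ∧ j = 1 then
    eqToHom (congrArg (fourObj X0 X1 X2 X3) hij.1) ≫ (h : X2 ⟶ Y1) ≫
      eqToHom (congrArg (fourObj Y0 Y1 Y2 Y3) hij.2.symm)
  else 0

omit [HasBinaryBiproducts 𝒞] in
theorem fourPrehomotopy_two_one {X0 X1 X2 X3 Y0 Y1 Y2 Y3 : 𝒞} (h : X2 ⟶ Y1) :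
    (fourPrehomotopy h 2 1 : fourObj X0 X1 X2 X3 2 ⟶ fourObj Y0 Y1 Y2 Y3 1) = h := by
  rw [fourPrehomotopy, dif_pos ⟨rfl, rfl⟩]
  exact (Category.id_comp _).trans (Category.comp_id h)

omit [HasBinaryBiproducts 𝒞] in
theorem fourPrehomotopy_eq_zero {X0 X1 X2 X3 Y0 Y1 Y2 Y3 : 𝒞} (h : X2 ⟶ Y1) {i j : ℤ}
    (hij : ¬(i = 2 ∧ j = 1)) :
    (fourPrehomotopy h i j : fourObj X0 X1 X2 X3 i ⟶ fourObj Y0 Y1 Y2 Y3 j) = 0 :=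
  dif_neg hij

/-- A homotopy between chain maps of four-term complexes whose only nonzero component goes from
degree `2` to degree `1`. -/
noncomputable def fourHomotopy {X0 X1 X2 X3 Y0 Y1 Y2 Y3 : 𝒞} {d0 : X0 ⟶ X1} {d1 : X1 ⟶ X2}
    {d2 : X2 ⟶ X3} {e0 : Y0 ⟶ Y1} {e1 : Y1 ⟶ Y2} {e2 : Y2 ⟶ Y3}
    {hd : ∀ n, fourDiff X0 X1 X2 X3 d0 d1 d2 n ≫ fourDiff X0 X1 X2 X3 d0 d1 d2 (n + 1) = 0}
    {he : ∀ n, fourDiff Y0 Y1 Y2 Y3 e0 e1 e2 n ≫ fourDiff Y0 Y1 Y2 Y3 e0 e1 e2 (n + 1) = 0}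
    (f g : CochainComplex.of (fourObj X0 X1 X2 X3) (fourDiff X0 X1 X2 X3 d0 d1 d2) hd ⟶
      CochainComplex.of (fourObj Y0 Y1 Y2 Y3) (fourDiff Y0 Y1 Y2 Y3 e0 e1 e2) he)
    (h : X2 ⟶ Y1) {g1 : X1 ⟶ Y1} {g2 : X2 ⟶ Y2} (hg1 : g.f 1 = g1) (hg2 : g.f 2 = g2)
    (h0 : f.f 0 = g.f 0) (h1 : f.f 1 = d1 ≫ h + g1) (h2 : f.f 2 = h ≫ e1 + g2)
    (h3 : f.f 3 = g.f 3) :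
    Homotopy f g where
  hom := fourPrehomotopy h
  zero i j hij := fourPrehomotopy_eq_zero h fun ⟨hi, hj⟩ => hij (by rw [hi, hj]; rfl)
  comm n := by
    rw [dNext_eq _ (show (ComplexShape.up ℤ).Rel n (n + 1) from rfl),
      prevD_eq _ (show (ComplexShape.up ℤ).Rel (n - 1) n from sub_add_cancel n 1)]
    by_cases n0 : n = 0
    · subst n0
      rw [fourPrehomotopy_eq_zero h (by decide), fourPrehomotopy_eq_zero h (by decide), h0,
        comp_zero, zero_comp, zero_add, zero_add]
    by_cases n1 : n = 1
    · subst n1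
      rw [fourPrehomotopy_eq_zero h (i := 1) (by decide), zero_comp, add_zero,
        cochainComplex_of_d]
      refine h1.trans ?_
      rw [← hg1]
      exact congrArg (fun k : X2 ⟶ Y1 => d1 ≫ k + (show X1 ⟶ Y1 from g.f 1))
        (fourPrehomotopy_two_one h).symm
    by_cases n2 : n = 2
    · subst n2
      rw [fourPrehomotopy_eq_zero h (i := 2 + 1) (by decide), comp_zero, zero_add,
        show (2 : ℤ) - 1 = 1 from rfl]
      have hd1 := cochainComplex_of_d (fourObj Y0 Y1 Y2 Y3) (fourDiff Y0 Y1 Y2 Y3 e0 e1 e2) he 1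
      refine h2.trans ?_
      rw [← hg2]
      exact congrArg₂ (fun (k : X2 ⟶ Y1) (e : Y1 ⟶ Y2) => k ≫ e + (show X2 ⟶ Y2 from g.f 2))
        (fourPrehomotopy_two_one h).symm hd1.symm
    by_cases n3 : n = 3
    · subst n3
      rw [fourPrehomotopy_eq_zero h (by decide), fourPrehomotopy_eq_zero h (by decide), h3,
        comp_zero, zero_comp, zero_add, zero_add]
    · exact (isZero_fourObj _ _ _ _ n0 n1 n2 n3).eq_of_src _ _

/-- **Gaussian elimination / reduction lemma.**  Given a four-term cochain complex
`C ⟶ b₁ ⊞ D ⟶ b₂ ⊞ E ⟶ F` (concentrated in degrees `0,1,2,3`), whose first differential has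
components `α, β`, whose middle differential is the biproduct matrix with entries
`φ, δ, γ, ε`, and whose last differential has components `μ, ν`, if `φ : b₁ ⟶ b₂` is an
isomorphism then this complex is homotopy equivalent to the four-term complex
`C ⟶ D ⟶ E ⟶ F` with differentials `β`, `ε - δ ≫ inv φ ≫ γ` and `ν`. -/
theorem gaussian_elimination
    (C b₁ D b₂ E F : 𝒞)
    (α : C ⟶ b₁) (β : C ⟶ D) (φ : b₁ ⟶ b₂) (δ : D ⟶ b₂)
    (γ : b₁ ⟶ E) (ε : D ⟶ E) (μ : b₂ ⟶ F) (ν : E ⟶ F)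
    [IsIso φ]
    (hsq : ∀ n : ℤ,
      fourDiff C (b₁ ⊞ D) (b₂ ⊞ E) F (biprod.lift α β)
          (biprod.desc (biprod.lift φ γ) (biprod.lift δ ε)) (biprod.desc μ ν) n ≫
        fourDiff C (b₁ ⊞ D) (b₂ ⊞ E) F (biprod.lift α β)
          (biprod.desc (biprod.lift φ γ) (biprod.lift δ ε)) (biprod.desc μ ν) (n + 1) = 0)
    (hsq' : ∀ n : ℤ,
      fourDiff C D E F β (ε - δ ≫ inv φ ≫ γ) ν n ≫
        fourDiff C D E F β (ε - δ ≫ inv φ ≫ γ) ν (n + 1) = 0) :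
    Nonempty (HomotopyEquiv
      (CochainComplex.of
        (fourObj C (b₁ ⊞ D) (b₂ ⊞ E) F)
        (fourDiff C (b₁ ⊞ D) (b₂ ⊞ E) F (biprod.lift α β)
          (biprod.desc (biprod.lift φ γ) (biprod.lift δ ε)) (biprod.desc μ ν)) hsq)
      (CochainComplex.of
        (fourObj C D E F)
        (fourDiff C D E F β (ε - δ ≫ inv φ ≫ γ) ν) hsq')) := by
  have e0 : biprod.lift α β ≫ biprod.desc (biprod.lift φ γ) (biprod.lift δ ε) = 0 := hsq 0
  have e1 : biprod.desc (biprod.lift φ γ) (biprod.lift δ ε) ≫ biprod.desc μ ν = 0 := hsq 1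
  have hα : α ≫ φ = -(β ≫ δ) := by
    have := e0 =≫ biprod.fst
    simp only [biprod.lift_desc, Preadditive.add_comp, Category.assoc, biprod.lift_fst,
      zero_comp] at this
    exact eq_neg_of_add_eq_zero_left this
  have hα' : α = -(β ≫ δ ≫ inv φ) := by
    rw [← cancel_mono φ, hα]
    simp
  have hμ : φ ≫ μ = -(γ ≫ ν) := by
    have := biprod.inl ≫= e1
    simp only [biprod.inl_desc_assoc, biprod.lift_desc, comp_zero] at this
    exact eq_neg_of_add_eq_zero_left this
  have hμ' : μ = -(inv φ ≫ γ ≫ ν) := by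
    rw [← cancel_epi φ, hμ]
    simp
  let f := fourHom hsq hsq' (𝟙 C) biprod.snd (biprod.desc (-(inv φ ≫ γ)) (𝟙 E)) (𝟙 F)
    (by simp) (by ext <;> simp [sub_eq_neg_add]) (by ext <;> simp [hμ'])
  let g := fourHom hsq' hsq (𝟙 C) (biprod.lift (-(δ ≫ inv φ)) (𝟙 D)) biprod.inr (𝟙 F)
    (by ext <;> simp [hα']) (by ext <;> simp [sub_eq_neg_add]) (by simp)
  refine ⟨⟨f, g, fourHomotopy (f ≫ g) (𝟙 _) (-(biprod.fst ≫ inv φ ≫ biprod.inl))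
      (g1 := 𝟙 (b₁ ⊞ D)) (g2 := 𝟙 (b₂ ⊞ E)) rfl rfl ?_ ?_ ?_ ?_,
    fourHomotopy (g ≫ f) (𝟙 _) 0 (g1 := 𝟙 D) (g2 := 𝟙 E) rfl rfl ?_ ?_ ?_ ?_⟩⟩
  · exact Category.id_comp (𝟙 C)
  · change biprod.snd ≫ biprod.lift (-(δ ≫ inv φ)) (𝟙 D) = _
    ext <;> simp
  · change biprod.desc (-(inv φ ≫ γ)) (𝟙 E) ≫ biprod.inr = _
    ext <;> simp
  · exact Category.id_comp (𝟙 F)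
  · exact Category.id_comp (𝟙 C)
  · change biprod.lift (-(δ ≫ inv φ)) (𝟙 D) ≫ biprod.snd = _
    simp
  · change biprod.inr ≫ biprod.desc (-(inv φ ≫ γ)) (𝟙 E) = _
    simp
  · exact Category.id_comp (𝟙 F)
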